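/- Every lower triangular matrix P in SU(2,1;ℤ[i]) lies in the subgroup of invertible 3×3 complex matrices generated by the three matrices N_{(0,i)}, N_{(1+i,1)} and M_i. -/

import Mathlib

open Matrix Complex

/-- The matrix `C` of the quadratic form defining the Siegel domain. -/
noncomputable def Cmat : Matrix (Fin 3) (Fin 3) ℂ := !![0,0,-1; 0,1,0; -1,0,0]

/-- Membership in `SU(2,1)`: `Gᴴ C G = C` and `det G = 1`. -/
def inSU21 (G : Matrix (Fin 3) (Fin 3) ℂ) : Prop :=
  G.conjTranspose * Cmat * G = Cmat ∧ G.det = 1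

/-- A complex number is a Gaussian integer. -/
def IsGaussianInt (z : ℂ) : Prop := ∃ m n : ℤ, z = (m : ℂ) + (n : ℂ) * Complex.I

/-- The Heisenberg translation matrix `N_a` for `a = (a₁, a₂) ∈ ℂ²`. -/
noncomputable def N (a : ℂ × ℂ) : Matrix (Fin 3) (Fin 3) ℂ :=
  !![1, 0, 0; a.1, 1, 0; a.2, star a.1, 1]

/-- The rotation matrix `M_i = diag(i, -1, i)`. -/
noncomputable def Mi : Matrix (Fin 3) (Fin 3) ℂ :=
  !![Complex.I, 0, 0; 0, -1, 0; 0, 0, Complex.I]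

/-- The involution `J`. -/
noncomputable def Jmat : Matrix (Fin 3) (Fin 3) ℂ := !![0, 0, -1; 0, -1, 0; -1, 0, 0]

/-- `N_{(0,i)}` as an element of `SL(3,ℂ)`. -/
noncomputable def N0i : Matrix.SpecialLinearGroup (Fin 3) ℂ :=
  ⟨N (0, Complex.I), by simp [N, Matrix.det_fin_three]⟩

/-- `N_{(1+i,1)}` as an element of `SL(3,ℂ)`. -/
noncomputable def N1 : Matrix.SpecialLinearGroup (Fin 3) ℂ :=
  ⟨N (1 + Complex.I, 1), by simp [N, Matrix.det_fin_three]⟩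

/-- `M_i` as an element of `SL(3,ℂ)`. -/
noncomputable def MiSL : Matrix.SpecialLinearGroup (Fin 3) ℂ :=
  ⟨Mi, by simp [Mi, Matrix.det_fin_three]⟩

/-- `J` as an element of `SL(3,ℂ)`. -/
noncomputable def JSL : Matrix.SpecialLinearGroup (Fin 3) ℂ :=
  ⟨Jmat, by simp [Jmat, Matrix.det_fin_three]⟩

/-- `N_{(0,i)}` as an invertible matrix. -/
noncomputable def N0iGL : GL (Fin 3) ℂ := N0i.toGL
/-- `N_{(1+i,1)}` as an invertible matrix. -/
noncomputable def N1GL : GL (Fin 3) ℂ := N1.toGL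
/-- `M_i` as an invertible matrix. -/
noncomputable def MiGL : GL (Fin 3) ℂ := MiSL.toGL
/-- `J` as an invertible matrix. -/
noncomputable def JGL : GL (Fin 3) ℂ := JSL.toGL

/-- `P` is the matrix of an element of the subgroup generated by `N_{(0,i)}`, `N_{(1+i,1)}`
and `M_i`. -/
def IsGenerated (P : Matrix (Fin 3) (Fin 3) ℂ) : Prop :=
  ∃ g ∈ Subgroup.closure ({N0iGL, N1GL, MiGL} : Set (GL (Fin 3) ℂ)),
    (g : Matrix (Fin 3) (Fin 3) ℂ) = P

lemma IsGenerated.one : IsGenerated 1 := ⟨1, one_mem _, rfl⟩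

lemma IsGenerated.mul {P Q : Matrix (Fin 3) (Fin 3) ℂ} (hP : IsGenerated P)
    (hQ : IsGenerated Q) : IsGenerated (P * Q) := by
  obtain ⟨g, hg, rfl⟩ := hP
  obtain ⟨h, hh, rfl⟩ := hQ
  exact ⟨g * h, mul_mem hg hh, rfl⟩

lemma IsGenerated.of_mul_eq_one {P Q : Matrix (Fin 3) (Fin 3) ℂ} (hP : IsGenerated P)
    (h : P * Q = 1) : IsGenerated Q := by
  obtain ⟨g, hg, rfl⟩ := hP
  exact ⟨g⁻¹, inv_mem hg, Units.inv_eq_of_mul_eq_one_right h⟩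

lemma IsGenerated.pow {P : Matrix (Fin 3) (Fin 3) ℂ} (hP : IsGenerated P) (k : ℕ) :
    IsGenerated (P ^ k) := by
  obtain ⟨g, hg, rfl⟩ := hP
  exact ⟨g ^ k, pow_mem hg k, Units.val_pow_eq_pow_val g k⟩

lemma isGenerated_N_zero_I : IsGenerated (N (0, I)) :=
  ⟨N0iGL, Subgroup.subset_closure (by simp), rfl⟩

lemma isGenerated_N_one_add_I : IsGenerated (N (1 + I, 1)) :=
  ⟨N1GL, Subgroup.subset_closure (by simp), rfl⟩

lemma isGenerated_Mi : IsGenerated Mi :=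
  ⟨MiGL, Subgroup.subset_closure (by simp), rfl⟩

lemma N_mul_N (a b : ℂ × ℂ) :
    N a * N b = N (a.1 + b.1, a.2 + b.2 + star a.1 * b.1) := by
  ext i j
  fin_cases i <;> fin_cases j <;> simp [N, Matrix.mul_apply, Fin.sum_univ_three]
  all_goals ring

lemma N_zero : N (0, 0) = 1 := by
  ext i j
  fin_cases i <;> fin_cases j <;> simp [N]

lemma Mi_pow (k : ℕ) : Mi ^ k = !![I ^ k, 0, 0; 0, (-1) ^ k, 0; 0, 0, I ^ k] := by
  induction k with
  | zero =>
    ext i j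
    fin_cases i <;> fin_cases j <;> simp
  | succ k ih =>
    rw [pow_succ, ih]
    ext i j
    fin_cases i <;> fin_cases j <;> simp [Mi, Matrix.mul_apply, Fin.sum_univ_three, pow_succ]

lemma Mi_mul_N_mul_Mi_pow_three (a : ℂ × ℂ) : Mi * N a * Mi ^ 3 = N (I * a.1, a.2) := by
  rw [Mi_pow]
  ext i j
  fin_cases i <;> fin_cases j <;>
    simp [N, Mi, Matrix.mul_apply, Fin.sum_univ_three, pow_succ, mul_comm, mul_left_comm]
  linear_combination -a.2 * I_sq

lemma isGenerated_N_zero_mul_I (n : ℤ) : IsGenerated (N (0, n * I)) := by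
  have hinv : IsGenerated (N (0, -I)) :=
    isGenerated_N_zero_I.of_mul_eq_one (by rw [N_mul_N, ← N_zero]; simp)
  induction n using Int.induction_on with
  | zero => simpa [N_zero] using IsGenerated.one
  | succ n ih =>
    convert ih.mul isGenerated_N_zero_I using 1
    rw [N_mul_N]
    congr 2
    · simp
    · push_cast
      simp
      ring
  | pred n ih =>
    convert ih.mul hinv using 1
    rw [N_mul_N]
    congr 2
    · simp
    · push_cast
      simp
      ring

lemma isGenerated_N_mul_one_add_I (n : ℤ) : IsGenerated (N (n * (1 + I), n ^ 2)) := by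
  have hinv : IsGenerated (N (-(1 + I), 1)) := by
    refine isGenerated_N_one_add_I.of_mul_eq_one ?_
    rw [N_mul_N, ← N_zero]
    congr 2
    · simp
    · simp
      linear_combination I_sq
  induction n using Int.induction_on with
  | zero => simpa [N_zero] using IsGenerated.one
  | succ n ih =>
    convert ih.mul isGenerated_N_one_add_I using 1
    rw [N_mul_N]
    congr 2
    · push_cast; ring
    · simp
      linear_combination (n : ℂ) * I_sq
  | pred n ih =>
    convert ih.mul hinv using 1
    rw [N_mul_N]
    congr 2
    · push_cast; ring
    · simp
      linear_combination (n : ℂ) * I_sq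

lemma isGenerated_N_of_two_mul_eq {b₁ b₂ c₁ : ℤ} (c₂ : ℤ) (h : 2 * c₁ = b₁ ^ 2 + b₂ ^ 2) :
    IsGenerated (N (b₁ + b₂ * I, c₁ + c₂ * I)) := by
  obtain ⟨m, hm⟩ : Even (b₁ + b₂) := by
    have : Even (b₁ ^ 2 + b₂ ^ 2) := ⟨c₁, by linarith⟩
    simpa [Int.even_add, Int.even_pow] using this
  obtain ⟨n, rfl⟩ : ∃ n, b₁ = m - n := ⟨m - b₁, by ring⟩
  obtain rfl : b₂ = m + n := by linarith
  obtain rfl : c₁ = m ^ 2 + n ^ 2 := by linarith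
  have hrot := (isGenerated_Mi.mul (isGenerated_N_mul_one_add_I n)).mul (isGenerated_Mi.pow 3)
  rw [Mi_mul_N_mul_Mi_pow_three] at hrot
  convert ((isGenerated_N_mul_one_add_I m).mul hrot).mul
    (isGenerated_N_zero_mul_I (c₂ - 2 * m * n)) using 1
  simp only [N_mul_N]
  congr 2
  · push_cast
    linear_combination -(n : ℂ) * I_sq
  · simp
    linear_combination (m : ℂ) * n * I * I_sq

lemma IsGaussianInt.mul {z w : ℂ} (hz : IsGaussianInt z) (hw : IsGaussianInt w) :
    IsGaussianInt (z * w) := by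
  obtain ⟨a, b, rfl⟩ := hz
  obtain ⟨c, d, rfl⟩ := hw
  refine ⟨a * c - b * d, a * d + b * c, ?_⟩
  push_cast
  linear_combination (b : ℂ) * d * I_sq

lemma IsGaussianInt.star {z : ℂ} (hz : IsGaussianInt z) : IsGaussianInt (star z) := by
  obtain ⟨a, b, rfl⟩ := hz
  exact ⟨a, -b, by simp⟩

lemma isGenerated_N {b c : ℂ} (hb : IsGaussianInt b) (hc : IsGaussianInt c)
    (h : c + star c = b * star b) : IsGenerated (N (b, c)) := by
  obtain ⟨b₁, b₂, rfl⟩ := hb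
  obtain ⟨c₁, c₂, rfl⟩ := hc
  refine isGenerated_N_of_two_mul_eq c₂ ?_
  simp at h
  have h' : (2 * c₁ : ℂ) = b₁ ^ 2 + b₂ ^ 2 := by linear_combination h - (b₂ : ℂ) ^ 2 * I_sq
  exact_mod_cast h'

lemma IsGaussianInt.exists_eq_I_pow {z w : ℂ} (hz : IsGaussianInt z) (hw : IsGaussianInt w)
    (h : z * w = 1) : ∃ k : ℕ, z = I ^ k := by
  obtain ⟨a, b, rfl⟩ := hz
  obtain ⟨c, d, rfl⟩ := hw
  have hn := congrArg normSq h
  rw [map_mul, normSq_one, normSq_apply, normSq_apply] at hn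
  simp at hn
  have hn' : (a * a + b * b) * (c * c + d * d) = 1 := by exact_mod_cast hn
  have h1 : a * a + b * b = 1 :=
    Int.eq_one_of_mul_eq_one_right (by nlinarith) hn'
  have ha : -1 ≤ a ∧ a ≤ 1 := ⟨by nlinarith, by nlinarith⟩
  have hb : -1 ≤ b ∧ b ≤ 1 := ⟨by nlinarith, by nlinarith⟩
  obtain ⟨ha₁, ha₂⟩ := ha
  obtain ⟨hb₁, hb₂⟩ := hb
  interval_cases a <;> interval_cases b <;> simp at h1
  · exact ⟨2, by simp⟩
  · exact ⟨3, by simp⟩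
  · exact ⟨1, by simp⟩
  · exact ⟨0, by simp⟩

/-- Every lower triangular matrix in `SU(2,1;ℤ[i])` lies in the subgroup generated by
`N_{(0,i)}`, `N_{(1+i,1)}` and `M_i`. -/
theorem stabilizer_of_infinity_generated (P : Matrix (Fin 3) (Fin 3) ℂ)
    (hP : inSU21 P) (hZ : ∀ j k, IsGaussianInt (P j k))
    (hlt : P 0 1 = 0 ∧ P 0 2 = 0 ∧ P 1 2 = 0) :
    ∃ g ∈ Subgroup.closure ({N0iGL, N1GL, MiGL} : Set (GL (Fin 3) ℂ)),
      (g : Matrix (Fin 3) (Fin 3) ℂ) = P := by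
  obtain ⟨hC, hdet⟩ := hP
  obtain ⟨h01, h02, h12⟩ := hlt
  have h02' := congrFun (congrFun hC 0) 2
  have h01' := congrFun (congrFun hC 0) 1
  have h00' := congrFun (congrFun hC 0) 0
  simp [Cmat, Matrix.mul_apply, Fin.sum_univ_three, h01, h02, h12] at h02' h01' h00'
  simp [Matrix.det_fin_three, h01, h02, h12] at hdet
  obtain ⟨k, hk⟩ := (hZ 0 0).exists_eq_I_pow ((hZ 1 1).mul (hZ 2 2))
    (by linear_combination hdet)
  have hsq : P 0 0 ^ 2 = (-1) ^ k := by rw [hk, ← pow_mul, mul_comm, pow_mul, I_sq]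
  have hstar : P 0 0 * starRingEnd ℂ (P 0 0) = 1 := by
    rw [hk, map_pow, ← mul_pow]; simp
  have h4 : P 0 0 ^ 4 = 1 := by rw [hk, ← pow_mul, mul_comm, pow_mul, I_pow_four, one_pow]
  have h22 : P 2 2 = P 0 0 := by linear_combination P 0 0 * h02' - P 2 2 * hstar
  rw [h22] at hdet
  have h11 : P 1 1 = P 0 0 ^ 2 := by linear_combination P 0 0 ^ 2 * hdet - P 1 1 * h4
  have h21 : P 2 1 = P 0 0 ^ 3 * starRingEnd ℂ (P 1 0) := by
    rw [h11] at h01'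
    linear_combination -P 0 0 * h01' - P 2 1 * hstar
  have hgen := (isGenerated_N ((hZ 1 0).mul (hZ 0 0).star) ((hZ 2 0).mul (hZ 0 0).star)
    (by
      simp only [star_def, map_mul, conj_conj]
      linear_combination -h00' - P 1 0 * starRingEnd ℂ (P 1 0) * hstar)).mul (isGenerated_Mi.pow k)
  change IsGenerated P
  convert hgen using 1
  rw [Mi_pow, ← hk, ← hsq]
  ext i j
  fin_cases i <;> fin_cases j <;>
    simp [N, Matrix.mul_apply, Fin.sum_univ_three, h01, h02, h12, h11, h22]
  · linear_combination -P 1 0 * hstar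
  · linear_combination -P 2 0 * hstar
  · rw [h21]
    ring
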